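/- arXiv:1404.4973 — 4 statements merged into one kernel-verified Lean document; each statement's English description precedes it below -/
import Mathlib

section
/- Let n ≥ 1 and N ≥ 1, and let h : Fin n → ZMod N be a hat assignment. If a : Fin n → ZMod N satisfies, for every i : Fin n, the zero-sum condition (Σ_{j < i} h(j)) + a(i) + (Σ_{j > i} a(j)) = 0 in ZMod N, then a(i) = h(i) for every i with i < n-1. That is, under the zero-sum announcement strategy every logician except possibly the last one announces his own hat color correctly. -/
open Finset in
/-- `n ≥ 1` logicians, hat colors in `ZMod N` with `N ≥ 1`.  If the
announcements `a` satisfy the zero-sum condition — for every `i`, the sum of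
the hats logician `i` sees, his own announcement, and the announcements he
hears is zero — then every logician except possibly the last one (position
`n-1`) announces his own hat color correctly. -/
theorem stmt5 (n N : ℕ) (hn : 1 ≤ n) (hN : 1 ≤ N)
    (h a : Fin n → ZMod N)
    (ha : ∀ i : Fin n,
      (∑ j ∈ univ.filter (fun j => j < i), h j) + a i +
        (∑ j ∈ univ.filter (fun j => i < j), a j) = 0) :
    ∀ i : Fin n, (i : ℕ) < n - 1 → a i = h i := by
  intro i hi
  obtain ⟨k, hk⟩ : ∃ k : Fin n, (k : ℕ) = i + 1 := ⟨⟨i + 1, by omega⟩, rfl⟩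
  have seen : univ.filter (fun j => j < k) = insert i (univ.filter (fun j => j < i)) := by
    ext j
    simp only [mem_filter, mem_univ, true_and, mem_insert, Fin.lt_def, Fin.ext_iff]
    omega
  have heard : univ.filter (fun j => i < j) = insert k (univ.filter (fun j => k < j)) := by
    ext j
    simp only [mem_filter, mem_univ, true_and, mem_insert, Fin.lt_def, Fin.ext_iff]
    omega
  have sum_i := ha i
  have sum_k := ha k
  rw [heard, sum_insert (by simp)] at sum_i
  rw [seen, sum_insert (by simp)] at sum_k
  linear_combination sum_i - sum_k
end

section
/- Let n ≥ 1 and N ≥ 1. There exists a family of guessing functions g, where for each i : Fin n, g(i) takes as input the hats in front of logician i (a function on {j : Fin n // j < i} with values in ZMod N) and the announcements behind logician i (a function on {j : Fin n // j > i} with values in ZMod N) and outputs an element of ZMod N, such that for every hat assignment h : Fin n → ZMod N and every announcement sequence a : Fin n → ZMod N satisfying a(i) = g(i)(h restricted to positions below i, a restricted to positions above i) for all i, we have a(i) = h(i) for every i with i < n-1. -/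
/-- `n ≥ 1` logicians, hat colors in `ZMod N` with `N ≥ 1`.  There is a family
of guessing functions `g` — logician `i`'s guess depends on the hats in front
of him (positions `j < i`) and the announcements behind him (positions
`j > i`) — such that whenever every logician follows his guessing function,
every logician except possibly the last one announces his own hat color
correctly. -/
theorem stmt6 (n N : ℕ) (hn : 1 ≤ n) (hN : 1 ≤ N) :
    ∃ g : (i : Fin n) → ({j : Fin n // j < i} → ZMod N) →
      ({j : Fin n // i < j} → ZMod N) → ZMod N,
      ∀ (h a : Fin n → ZMod N),
        (∀ i : Fin n, a i = g i (fun j => h j.1) (fun j => a j.1)) →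
        ∀ i : Fin n, (i : ℕ) < n - 1 → a i = h i := by
  obtain ⟨m, rfl⟩ : ∃ m, n = m + 1 := ⟨n - 1, by omega⟩
  refine ⟨fun i front back =>
    if hi : i < Fin.last m then
      back ⟨Fin.last m, hi⟩ - (∑ j, if hj : j < i then front ⟨j, hj⟩ else 0)
        - ∑ j, if hj : i < j then (if j < Fin.last m then back ⟨j, hj⟩ else 0) else 0
    else ∑ j, if hj : j < i then front ⟨j, hj⟩ else 0, ?_⟩
  intro h a ha i hi
  have hlast : a (Fin.last m) = ∑ j, if j < Fin.last m then h j else 0 := by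
    simpa using ha (Fin.last m)
  have key (i : Fin (m + 1)) : i < Fin.last m → a i = h i := by
    induction i using WellFoundedGT.induction with
    | ind i ih =>
      intro hi
      have hback : (∑ j, if i < j then (if j < Fin.last m then a j else 0) else 0) =
          ∑ j, if i < j then (if j < Fin.last m then h j else 0) else 0 := by
        refine Finset.sum_congr rfl fun j _ => ?_
        split_ifs with hij hj
        exacts [ih j hij hj, rfl, rfl]
      have hsplit : (∑ j, if j < Fin.last m then h j else 0) =
          (∑ j, if j < i then h j else 0) +
          (∑ j, if i < j then (if j < Fin.last m then h j else 0) else 0) + h i := by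
        have hself : h i = ∑ j, if j = i then h j else 0 := by simp
        rw [hself, ← Finset.sum_add_distrib, ← Finset.sum_add_distrib]
        refine Finset.sum_congr rfl fun j _ => ?_
        rcases lt_trichotomy j i with hj | rfl | hj
        · simp [hj, hj.trans hi, hj.not_gt, hj.ne]
        · simp [hi]
        · simp [hj, hj.not_gt, hj.ne']
      have hai := ha i
      simp only [hi, if_true, dite_eq_ite] at hai
      rw [hai, hback, hlast, hsplit]
      ring
  exact key i (by simpa [Fin.lt_def] using hi)
end

section
/- Let n ≥ 1 and let h : Fin n → ZMod (n+1) be an injective hat assignment (n logicians wearing n pairwise distinct colors out of n+1 possible colors). Let s := −Σ_{j < n-1} h(j), the last logician's zero-sum announcement. If s ≠ h(i) for every i < n-1, then the sequence a : Fin n → ZMod (n+1) defined by a(i) = h(i) for i < n-1 and a(n-1) = s satisfies the zero-sum condition (Σ_{j < i} h(j)) + a(i) + (Σ_{j > i} a(j)) = 0 for every i, is injective (no announced color is ever repeated), and agrees with h at every position except possibly n-1. -/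
open Finset in
/-- `n ≥ 1` logicians wear pairwise distinct hats drawn from `n+1` colors,
identified with `ZMod (n+1)`.  Let `s` be the last logician's zero-sum
announcement, the negative of the sum of the hats he sees.  If `s` differs
from every hat in front of him, then the announcement sequence `a` with
`a i = h i` for `i < n-1` and `a (n-1) = s` satisfies the zero-sum condition
at every position, is injective (no color is ever repeated), and agrees with
`h` everywhere except possibly at position `n-1`. -/
theorem stmt7 (n : ℕ) (hn : 1 ≤ n) (h : Fin n → ZMod (n + 1))
    (hinj : Function.Injective h)
    (s : ZMod (n + 1))
    (hs : s = -∑ j ∈ univ.filter (fun j : Fin n => (j : ℕ) < n - 1), h j)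
    (hne : ∀ i : Fin n, (i : ℕ) < n - 1 → s ≠ h i)
    (a : Fin n → ZMod (n + 1))
    (ha : ∀ i : Fin n, a i = if (i : ℕ) < n - 1 then h i else s) :
    (∀ i : Fin n,
      (∑ j ∈ univ.filter (fun j => j < i), h j) + a i +
        (∑ j ∈ univ.filter (fun j => i < j), a j) = 0) ∧
    Function.Injective a ∧
    (∀ i : Fin n, (i : ℕ) < n - 1 → a i = h i) := by
  have hlt : ∀ i : Fin n, (i : ℕ) < n - 1 → a i = h i := fun i hi => by rw [ha, if_pos hi]
  have htotal : ∑ j, a j = 0 := by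
    have hlast : univ.filter (fun j : Fin n => ¬ (j : ℕ) < n - 1) = {⟨n - 1, by omega⟩} := by
      ext j
      simp only [mem_filter, mem_univ, true_and, mem_singleton, Fin.ext_iff]
      omega
    simp_rw [ha]
    rw [sum_ite, hlast, sum_singleton, hs, add_neg_cancel]
  refine ⟨fun i => ?_, fun i j hij => ?_, hlt⟩
  · have hfront : ∑ j ∈ univ.filter (fun j => j < i), h j =
        ∑ j ∈ univ.filter (fun j => j < i), a j := by
      refine sum_congr rfl fun j hj => (hlt j ?_).symm
      have hji : j < i := (mem_filter.mp hj).2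
      omega
    have hback : univ.filter (fun j => ¬ j < i) = insert i (univ.filter (fun j => i < j)) := by
      ext j
      simp only [mem_filter, mem_univ, true_and, mem_insert]
      omega
    rw [hfront, ← htotal, ← sum_filter_add_sum_filter_not univ (fun j => j < i), hback,
      sum_insert (by simp), add_assoc]
  · rw [ha, ha] at hij
    split_ifs at hij with hi hj hj
    · exact hinj hij
    · exact absurd hij.symm (hne i hi)
    · exact absurd hij (hne j hj)
    · omega
end

section
/- Let n ≥ 3 and let h : Fin n → ZMod (n+1) be an injective hat assignment. Let s := −Σ_{j < n-1} h(j), and suppose there is an index i* with 0 < i* < n-1 and h(i*) = s (so the last logician's zero-sum announcement coincides with the hat color of logician i*). Suppose a : Fin n → ZMod (n+1) satisfies: (i) a(n-1) = s; (ii) for every j with i* < j < n-1, the zero-sum condition (Σ_{k < j} h(k)) + a(j) + (Σ_{k > j} a(k)) = 0; (iii) a(i*) = h(0) (logician i*, unable to repeat his own color, announces the front logician's color); (iv) for every j with 0 < j < i*, a(j) = −2s − (Σ_{k < j} h(k)) − (Σ_{k : j < k < n-1, k ≠ i*} a(k)) (these logicians, detecting the conflict, deduce their colors knowing that logician i*'s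 true color is s). Then a(j) = h(j) for every j with 0 < j < n-1 and j ≠ i*; moreover the announcements a(1), a(2), …, a(n-1) are pairwise distinct. Hence at most three logicians — the last one, logician i*, and the front logician — can announce a wrong color. -/
open Finset in
/-- A sum over the disjoint union of the index sets cut out by `q` and `{i}`. -/
theorem sum_filter_eq_sum_filter_add_single {ι M : Type*} [Fintype ι] [DecidableEq ι]
    [AddCommMonoid M] (f : ι → M) (i : ι) (p q : ι → Prop) [DecidablePred p] [DecidablePred q]
    (hi : ¬ q i) (hpq : ∀ k, p k ↔ q k ∨ k = i) :
    ∑ k ∈ univ.filter p, f k = ∑ k ∈ univ.filter q, f k + f i := by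
  have hset : univ.filter p = insert i (univ.filter q) := by
    ext k
    simp [hpq k, or_comm]
  rw [hset, sum_insert (by simpa using hi), add_comm]

open Finset in
/-- A sum over the indices below `m` split at the index `j`. -/
theorem Fin.sum_filter_val_lt_split {n : ℕ} {M : Type*} [AddCommMonoid M] (f : Fin n → M)
    (m : ℕ) (j : Fin n) (hj : (j : ℕ) < m) :
    ∑ k ∈ univ.filter (fun k : Fin n => (k : ℕ) < m), f k =
      ∑ k ∈ univ.filter (fun k => k < j), f k + f j +
        ∑ k ∈ univ.filter (fun k : Fin n => (j : ℕ) < (k : ℕ) ∧ (k : ℕ) < m), f k := by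
  rw [← sum_filter_eq_sum_filter_add_single f j (fun k => k ≤ j) (fun k => k < j)
    (lt_irrefl j) (fun k => le_iff_lt_or_eq), ← sum_union]
  · congr 1
    ext k
    simp only [mem_filter, mem_univ, true_and, mem_union, Fin.le_def]
    omega
  · rw [disjoint_filter]
    intro k _ hk
    rw [Fin.le_def] at hk
    omega

open Finset in
/-- `n ≥ 3` logicians wear pairwise distinct hats drawn from `n+1` colors,
identified with `ZMod (n+1)`.  The last logician's zero-sum announcement
`s = -∑_{j<n-1} h j` coincides with the hat color of some logician `i*` with
`0 < i* < n-1`.  Suppose: (i) the last logician announces `s`; (ii) every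
logician strictly between `i*` and `n-1` follows the zero-sum rule;
(iii) logician `i*`, unable to repeat his own color, announces the front
logician's color `h 0`; (iv) every logician strictly between `0` and `i*`,
detecting the conflict, deduces his color knowing that logician `i*`'s true
color is `s`.  Then every logician `j` with `0 < j < n-1`, `j ≠ i*` announces
his own color correctly, and the announcements at positions `1, …, n-1` are
pairwise distinct — so at most three logicians (the last, `i*`, and the front
one) can be wrong. -/
theorem stmt8 (n : ℕ) (hn : 3 ≤ n) (h : Fin n → ZMod (n + 1))
    (hinj : Function.Injective h)
    (s : ZMod (n + 1))
    (hs : s = -∑ j ∈ univ.filter (fun j : Fin n => (j : ℕ) < n - 1), h j)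
    (istar : Fin n) (histar0 : 0 < (istar : ℕ)) (histar1 : (istar : ℕ) < n - 1)
    (hcoll : h istar = s)
    (a : Fin n → ZMod (n + 1))
    (hlast : a ⟨n - 1, by omega⟩ = s)
    (hmid : ∀ j : Fin n, (istar : ℕ) < (j : ℕ) → (j : ℕ) < n - 1 →
      (∑ k ∈ univ.filter (fun k => k < j), h k) + a j +
        (∑ k ∈ univ.filter (fun k => j < k), a k) = 0)
    (hstar : a istar = h ⟨0, by omega⟩)
    (hfront : ∀ j : Fin n, 0 < (j : ℕ) → (j : ℕ) < (istar : ℕ) →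
      a j = -(2 * s) - (∑ k ∈ univ.filter (fun k => k < j), h k) -
        (∑ k ∈ univ.filter
          (fun k : Fin n => (j : ℕ) < (k : ℕ) ∧ (k : ℕ) < n - 1 ∧ k ≠ istar), a k)) :
    (∀ j : Fin n, 0 < (j : ℕ) → (j : ℕ) < n - 1 → j ≠ istar → a j = h j) ∧
    (∀ j k : Fin n, 0 < (j : ℕ) → 0 < (k : ℕ) → j ≠ k → a j ≠ a k) := by
  have correct : ∀ j : Fin n, 0 < (j : ℕ) → (j : ℕ) < n - 1 → j ≠ istar → a j = h j := by
    intro j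
    induction j using WellFoundedGT.induction with
    | ind j ih =>
      intro hj0 hj1 hne
      have hsplit := Fin.sum_filter_val_lt_split h (n - 1) j hj1
      rcases lt_or_gt_of_ne hne with hlt | hgt
      · have hrest := sum_filter_eq_sum_filter_add_single h istar
          (fun k : Fin n => (j : ℕ) < (k : ℕ) ∧ (k : ℕ) < n - 1)
          (fun k : Fin n => (j : ℕ) < (k : ℕ) ∧ (k : ℕ) < n - 1 ∧ k ≠ istar)
          (by simp) (by grind)
        have hcongr : ∑ k ∈ univ.filter
            (fun k : Fin n => (j : ℕ) < (k : ℕ) ∧ (k : ℕ) < n - 1 ∧ k ≠ istar), a k =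
            ∑ k ∈ univ.filter
            (fun k : Fin n => (j : ℕ) < (k : ℕ) ∧ (k : ℕ) < n - 1 ∧ k ≠ istar), h k := by
          refine sum_congr rfl fun k hk => ?_
          simp only [mem_filter, mem_univ, true_and] at hk
          exact ih k hk.1 (by omega) hk.2.1 hk.2.2
        rw [hfront j hj0 hlt, hcongr]
        linear_combination -hs + hcoll + hsplit + hrest
      · have hrest := sum_filter_eq_sum_filter_add_single a ⟨n - 1, by omega⟩
          (fun k => j < k) (fun k : Fin n => (j : ℕ) < (k : ℕ) ∧ (k : ℕ) < n - 1)
          (by simp) (fun k => by simp only [Fin.lt_def, Fin.ext_iff]; omega)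
        have hcongr : ∑ k ∈ univ.filter
            (fun k : Fin n => (j : ℕ) < (k : ℕ) ∧ (k : ℕ) < n - 1), a k =
            ∑ k ∈ univ.filter (fun k : Fin n => (j : ℕ) < (k : ℕ) ∧ (k : ℕ) < n - 1), h k := by
          refine sum_congr rfl fun k hk => ?_
          simp only [mem_filter, mem_univ, true_and] at hk
          exact ih k hk.1 (by omega) hk.2 (hgt.trans hk.1).ne'
        linear_combination hmid j hgt hj1 - hrest - hcongr - hlast - hs + hsplit
  refine ⟨correct, ?_⟩
  have value : ∀ j : Fin n, 0 < (j : ℕ) →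
      (j = istar ∧ a j = h ⟨0, by omega⟩) ∨ ((j : ℕ) = n - 1 ∧ a j = h istar) ∨
        (j ≠ istar ∧ (j : ℕ) ≠ n - 1 ∧ a j = h j) := by
    intro j hj0
    by_cases hji : j = istar
    · exact Or.inl ⟨hji, hji ▸ hstar⟩
    by_cases hjn : (j : ℕ) = n - 1
    · have hlast_eq : j = ⟨n - 1, by omega⟩ := Fin.ext hjn
      exact Or.inr (Or.inl ⟨hjn, by rw [hlast_eq, hlast, hcoll]⟩)
    · exact Or.inr (Or.inr ⟨hji, hjn, correct j hj0 (by omega) hji⟩)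
  intro j k hj hk hjk heq
  rcases value j hj with ⟨hj1, hj2⟩ | ⟨hj1, hj2⟩ | ⟨hj1, hj3, hj2⟩ <;>
  rcases value k hk with ⟨hk1, hk2⟩ | ⟨hk1, hk2⟩ | ⟨hk1, hk3, hk2⟩ <;>
  · rw [hj2, hk2] at heq
    have hval := congrArg Fin.val (hinj heq)
    simp only [ne_eq, Fin.ext_iff] at hj1 hk1 hjk hval
    omega
end
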